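/- arXiv:2406.12659 — 2 statements merged into one kernel-verified Lean document; each statement's English description precedes it below -/
import Mathlib

section
/- Under the posterior distribution Π(·|Y), the transformed coordinates β*_{1:k} and β₋ₖ are independent; more precisely, the pushforward of Π(·|Y) under the bijection β ↦ (β*_{1:k}, β₋ₖ) equals the product measure ν₁ ⊗ ν₂, where ν₁ is the probability measure on ℝᵏ with density proportional to x ↦ exp(−(x − Σ_kX_{1:k}ᵀY)ᵀ Σ_k⁻¹ (x − Σ_kX_{1:k}ᵀY)/2) g(x) with respect to Lebesgue measure, and ν₂ is the probability measure on ℝ^{p−k} with dν₂(β₋ₖ) proportional to exp(−‖Y̌_k − W̌_kβ₋ₖ‖₂²/2) dμ(β₋ₖ). -/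
open Matrix Finset MeasureTheory

/-- Normalization of a (finite, nonzero) measure into a probability measure. -/
noncomputable def probNormalize {α : Type*} [MeasurableSpace α]
    (ρ : MeasureTheory.Measure α) : MeasureTheory.Measure α :=
  (ρ Set.univ)⁻¹ • ρ

/-- Pushing forward a density that factors through a measure-preserving map. -/
theorem MeasureTheory.MeasurePreserving.map_withDensity_comp {α β : Type*}
    [MeasurableSpace α] [MeasurableSpace β] {ρ : Measure α} {τ : Measure β} {T : α → β}
    (hT : MeasurePreserving T ρ τ) {F : β → ENNReal} (hF : Measurable F) :
    (ρ.withDensity (fun a => F (T a))).map T = τ.withDensity F := by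
  ext s hs
  rw [Measure.map_apply hT.measurable hs, withDensity_apply _ (hT.measurable hs),
    withDensity_apply _ hs, hT.setLIntegral_comp_preimage hs hF]

/-- Translating the first coordinate by a measurable function of the second preserves
the product of an invariant measure with any s-finite measure. -/
theorem measurePreserving_shear_fst {G β : Type*} [MeasurableSpace G] [AddGroup G]
    [MeasurableAdd₂ G] [MeasurableSpace β] (lam : Measure G) [SFinite lam]
    [lam.IsAddRightInvariant] (μ : Measure β) [SFinite μ] {s : β → G} (hs : Measurable s) :
    MeasurePreserving (fun z : G × β => (z.1 + s z.2, z.2)) (lam.prod μ) (lam.prod μ) := by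
  have h : MeasurePreserving (fun p : β × G => (p.1, p.2 + s p.1)) (μ.prod lam) (μ.prod lam) :=
    (MeasurePreserving.id μ).skew_product (g := fun b x => x + s b)
      (measurable_snd.add (hs.comp measurable_fst))
      (Filter.Eventually.of_forall fun b => map_add_right_eq_self lam (s b))
  exact Measure.measurePreserving_swap.comp (h.comp Measure.measurePreserving_swap)

/-- Normalization commutes with products of nonzero finite measures. -/
theorem probNormalize_prod {α β : Type*} [MeasurableSpace α] [MeasurableSpace β]
    (ρ : Measure α) (τ : Measure β) [SFinite ρ] [SFinite τ]
    (h0 : (ρ.prod τ) Set.univ ≠ 0) :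
    probNormalize (ρ.prod τ) = (probNormalize ρ).prod (probNormalize τ) := by
  have hprod : (ρ.prod τ) Set.univ = ρ Set.univ * τ Set.univ := by
    rw [← Set.univ_prod_univ, Measure.prod_prod]
  have hρ : ρ Set.univ ≠ 0 := fun h => h0 (by rw [hprod, h, zero_mul])
  have hτ : τ Set.univ ≠ 0 := fun h => h0 (by rw [hprod, h, mul_zero])
  ext s hs
  have hc : (τ Set.univ)⁻¹ ≠ ⊤ := ENNReal.inv_ne_top.2 hτ
  simp only [probNormalize]
  rw [Measure.prod_smul_left, Measure.smul_apply, Measure.smul_apply, Measure.prod_apply hs,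
    Measure.prod_apply hs, hprod, ENNReal.mul_inv (Or.inl hρ) (Or.inr hτ)]
  simp only [Measure.smul_apply, smul_eq_mul]
  rw [lintegral_const_mul' _ _ hc, mul_assoc]

theorem probNormalize_map {α β : Type*} [MeasurableSpace α] [MeasurableSpace β]
    (ρ : Measure α) {T : α → β} (hT : Measurable T) :
    (probNormalize ρ).map T = probNormalize (ρ.map T) := by
  simp only [probNormalize]
  rw [Measure.map_smul, Measure.map_apply hT MeasurableSet.univ, Set.preimage_univ]

theorem mulVec_fin_append {ι : Type*} {k m : ℕ} (X : Matrix ι (Fin (k + m)) ℝ)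
    (a : Fin k → ℝ) (b : Fin m → ℝ) :
    X.mulVec (Fin.append a b) = (Matrix.of fun i j => X i (Fin.castAdd m j)).mulVec a
      + (Matrix.of fun i j => X i (Fin.natAdd k j)).mulVec b := by
  ext i
  simp [Matrix.mulVec, dotProduct, Fin.sum_univ_add]

/-- Pythagorean decomposition of the residual sum of squares along the column space of `A`
and its orthogonal complement, the range of `P`. -/
theorem residual_sq_decomposition {ι κ τ σ : Type*} [Fintype ι] [Fintype κ] [Fintype τ]
    [Fintype σ] [DecidableEq ι] [DecidableEq κ] [DecidableEq σ]
    (A : Matrix ι κ ℝ) (B : Matrix ι τ ℝ) (P : Matrix ι σ ℝ)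
    (hA : IsUnit (Aᵀ * A).det) (hPtP : Pᵀ * P = 1)
    (hPPt : P * Pᵀ = 1 - A * (Aᵀ * A)⁻¹ * Aᵀ) (Y : ι → ℝ) (a : κ → ℝ) (b : τ → ℝ) :
    ∑ i, (Y i - (A *ᵥ a + B *ᵥ b) i) ^ 2
      = (a + (Aᵀ * A)⁻¹ *ᵥ (Aᵀ *ᵥ (B *ᵥ b)) - (Aᵀ * A)⁻¹ *ᵥ (Aᵀ *ᵥ Y)) ⬝ᵥ
          ((Aᵀ * A) *ᵥ
            (a + (Aᵀ * A)⁻¹ *ᵥ (Aᵀ *ᵥ (B *ᵥ b)) - (Aᵀ * A)⁻¹ *ᵥ (Aᵀ *ᵥ Y)))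
        + ∑ j, ((Pᵀ *ᵥ Y) j - ((Pᵀ * B) *ᵥ b) j) ^ 2 := by
  set S := (Aᵀ * A)⁻¹
  have hSA : S * (Aᵀ * A) = 1 := Matrix.nonsing_inv_mul _ hA
  have hAS : (Aᵀ * A) * S = 1 := Matrix.mul_nonsing_inv _ hA
  have hPA : Pᵀ * A = 0 := by
    have h : P * Pᵀ * A = 0 := by
      rw [hPPt, Matrix.sub_mul, Matrix.one_mul, Matrix.mul_assoc, Matrix.mul_assoc, hSA,
        Matrix.mul_one, sub_self]
    calc Pᵀ * A = Pᵀ * P * (Pᵀ * A) := by rw [hPtP, Matrix.one_mul]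
      _ = Pᵀ * (P * Pᵀ * A) := by simp only [Matrix.mul_assoc]
      _ = 0 := by rw [h, Matrix.mul_zero]
  set D : ι → ℝ := Y - (A *ᵥ a + B *ᵥ b) with hD
  have hx : a + S *ᵥ (Aᵀ *ᵥ (B *ᵥ b)) - S *ᵥ (Aᵀ *ᵥ Y) = -(S *ᵥ (Aᵀ *ᵥ D)) := by
    have h : S *ᵥ (Aᵀ *ᵥ (A *ᵥ a)) = a := by
      rw [Matrix.mulVec_mulVec, Matrix.mulVec_mulVec, Matrix.mul_assoc, hSA, Matrix.one_mulVec]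
    rw [hD, Matrix.mulVec_sub, Matrix.mulVec_sub, Matrix.mulVec_add, Matrix.mulVec_add, h]
    abel
  have hP : Pᵀ *ᵥ Y - (Pᵀ * B) *ᵥ b = Pᵀ *ᵥ D := by
    rw [hD, Matrix.mulVec_sub, Matrix.mulVec_add, Matrix.mulVec_mulVec, Matrix.mulVec_mulVec,
      hPA, Matrix.zero_mulVec, zero_add]
  have e1 : ∑ i, (Y i - (A *ᵥ a + B *ᵥ b) i) ^ 2 = D ⬝ᵥ D :=
    Finset.sum_congr rfl fun i _ => by rw [hD, Pi.sub_apply, sq]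
  have e2 : ∑ j, ((Pᵀ *ᵥ Y) j - ((Pᵀ * B) *ᵥ b) j) ^ 2 = (Pᵀ *ᵥ D) ⬝ᵥ (Pᵀ *ᵥ D) :=
    Finset.sum_congr rfl fun j _ => by rw [← hP, Pi.sub_apply, sq]
  have e3 : (Pᵀ *ᵥ D) ⬝ᵥ (Pᵀ *ᵥ D) = D ⬝ᵥ D - D ⬝ᵥ (A *ᵥ (S *ᵥ (Aᵀ *ᵥ D))) := by
    rw [Matrix.mulVec_transpose, ← Matrix.dotProduct_mulVec, ← Matrix.mulVec_transpose,
      Matrix.mulVec_mulVec, hPPt, Matrix.sub_mulVec, Matrix.one_mulVec, dotProduct_sub,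
      ← Matrix.mulVec_mulVec, ← Matrix.mulVec_mulVec]
  rw [e1, e2, e3, hx, Matrix.mulVec_neg, neg_dotProduct_neg, Matrix.mulVec_mulVec _ (Aᵀ * A),
    hAS, Matrix.one_mulVec, Matrix.dotProduct_mulVec D A, ← Matrix.mulVec_transpose,
    dotProduct_comm (S *ᵥ _)]
  ring

/-- Under the posterior `Π(·|Y)`, the transformed coordinates `β*_{1:k}` and
`β₋ₖ` are independent: the pushforward of the posterior under `β ↦ (β*_{1:k}, β₋ₖ)` equals
`ν₁ ⊗ ν₂`, where `ν₁ ∝ exp(−(x − Σ_kX_{1:k}ᵀY)ᵀ Σ_k⁻¹ (x − Σ_kX_{1:k}ᵀY)/2) g(x) dx` and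
`ν₂ ∝ exp(−‖Y̌_k − W̌_kβ₋ₖ‖₂²/2) dμ(β₋ₖ)`.
Here `ℝᵖ` is identified with `ℝᵏ × ℝ^{p−k}` via `β = (β_{1:k}, β₋ₖ)`, `n = k + ν`,
`p = k + m`, the prior is `(Leb_{ℝᵏ} ⊗ μ).withDensity (g(β_{1:k} + Σ_kX_{1:k}ᵀX₋ₖβ₋ₖ))`,
and the posterior is the normalized likelihood-weighted prior. -/
theorem stmt8 (k ν m : ℕ) (hk : 1 ≤ k) (hν : 1 ≤ ν) (hm : 1 ≤ m)
    (X : Matrix (Fin (k + ν)) (Fin (k + m)) ℝ)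
    (X1k : Matrix (Fin (k + ν)) (Fin k) ℝ)
    (hX1k : X1k = Matrix.of fun i j => X i (Fin.castAdd m j))
    (Xmk : Matrix (Fin (k + ν)) (Fin m) ℝ)
    (hXmk : Xmk = Matrix.of fun i j => X i (Fin.natAdd k j))
    (hindep : IsUnit (X1k.transpose * X1k).det)
    (Sk : Matrix (Fin k) (Fin k) ℝ) (hSk : Sk = (X1k.transpose * X1k)⁻¹)
    (P : Matrix (Fin (k + ν)) (Fin ν) ℝ)
    (hPtP : P.transpose * P = 1)
    (hPPt : P * P.transpose = 1 - X1k * Sk * X1k.transpose)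
    (g : (Fin k → ℝ) → ℝ) (hg_meas : Measurable g) (hg_pos : ∀ x, 0 < g x)
    (hg_int : ∫ x, g x = 1)
    (μ : Measure (Fin m → ℝ)) [IsProbabilityMeasure μ]
    (Y : Fin (k + ν) → ℝ)
    (priorM : Measure ((Fin k → ℝ) × (Fin m → ℝ)))
    (hpriorM : priorM = ((volume : Measure (Fin k → ℝ)).prod μ).withDensity
        (fun z => ENNReal.ofReal
          (g (z.1 + Sk.mulVec (X1k.transpose.mulVec (Xmk.mulVec z.2))))))
    (ρpost : Measure ((Fin k → ℝ) × (Fin m → ℝ)))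
    (hρpost : ρpost = priorM.withDensity
        (fun z => ENNReal.ofReal
          (Real.exp (-(∑ i, (Y i - X.mulVec (Fin.append z.1 z.2) i) ^ 2) / 2))))
    (hZpos : 0 < ρpost Set.univ) (hZfin : ρpost Set.univ < ⊤) :
    (probNormalize ρpost).map
        (fun z : (Fin k → ℝ) × (Fin m → ℝ) =>
          (z.1 + Sk.mulVec (X1k.transpose.mulVec (Xmk.mulVec z.2)), z.2))
      = (probNormalize ((volume : Measure (Fin k → ℝ)).withDensity
            (fun x => ENNReal.ofReal
              (Real.exp (-(dotProduct (x - Sk.mulVec (X1k.transpose.mulVec Y))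
                  (Sk⁻¹.mulVec (x - Sk.mulVec (X1k.transpose.mulVec Y)))) / 2) * g x)))).prod
        (probNormalize (μ.withDensity
            (fun b => ENNReal.ofReal
              (Real.exp (-(∑ j, (P.transpose.mulVec Y j
                  - (P.transpose * Xmk).mulVec b j) ^ 2) / 2))))) := by
  subst hSk
  have hmeas_mulVec : ∀ {a b : ℕ} (M : Matrix (Fin a) (Fin b) ℝ),
      Measurable fun v : Fin b → ℝ => M *ᵥ v := fun M =>
    (Continuous.matrix_mulVec continuous_const continuous_id).measurable
  set S := (X1k.transpose * X1k)⁻¹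
  set s : (Fin m → ℝ) → (Fin k → ℝ) := fun b => S *ᵥ (X1k.transpose *ᵥ (Xmk *ᵥ b))
  have hs : Measurable s := (hmeas_mulVec S).comp ((hmeas_mulVec _).comp (hmeas_mulVec Xmk))
  set c := S *ᵥ (X1k.transpose *ᵥ Y)
  set f₁ : (Fin k → ℝ) → ENNReal := fun x =>
    ENNReal.ofReal (Real.exp (-((x - c) ⬝ᵥ (S⁻¹ *ᵥ (x - c))) / 2) * g x) with hf₁
  set f₂ : (Fin m → ℝ) → ENNReal := fun b => ENNReal.ofReal
    (Real.exp (-(∑ j, (P.transpose.mulVec Y j - (P.transpose * Xmk).mulVec b j) ^ 2) / 2))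
    with hf₂
  have hf₁m : Measurable f₁ := by
    have : Continuous fun x : Fin k → ℝ => -((x - c) ⬝ᵥ (S⁻¹ *ᵥ (x - c))) / 2 := by fun_prop
    exact ((Real.measurable_exp.comp this.measurable).mul hg_meas).ennreal_ofReal
  have hf₂m : Measurable f₂ := by
    have : Continuous fun b : Fin m → ℝ =>
        -(∑ j, (P.transpose.mulVec Y j - (P.transpose * Xmk).mulVec b j) ^ 2) / 2 := by fun_prop
    exact (Real.measurable_exp.comp this.measurable).ennreal_ofReal
  have hT := measurePreserving_shear_fst (volume : Measure (Fin k → ℝ)) μ hs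
  have hpost : ρpost = ((volume : Measure (Fin k → ℝ)).prod μ).withDensity
      (fun z => (fun w : (Fin k → ℝ) × (Fin m → ℝ) => f₁ w.1 * f₂ w.2) (z.1 + s z.2, z.2)) := by
    have hlik : Measurable fun z : (Fin k → ℝ) × (Fin m → ℝ) => ENNReal.ofReal
        (Real.exp (-(∑ i, (Y i - X.mulVec (Fin.append z.1 z.2) i) ^ 2) / 2)) := by
      simp only [mulVec_fin_append]
      have : Continuous fun z : (Fin k → ℝ) × (Fin m → ℝ) => -(∑ i, (Y i -
          ((Matrix.of fun i j => X i (Fin.castAdd m j)).mulVec z.1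
            + (Matrix.of fun i j => X i (Fin.natAdd k j)).mulVec z.2) i) ^ 2) / 2 := by
        fun_prop
      exact (Real.measurable_exp.comp this.measurable).ennreal_ofReal
    have hprior : Measurable fun z : (Fin k → ℝ) × (Fin m → ℝ) => ENNReal.ofReal
        (g (z.1 + S *ᵥ (X1k.transpose *ᵥ (Xmk *ᵥ z.2)))) :=
      (hg_meas.comp (measurable_fst.comp hT.measurable)).ennreal_ofReal
    rw [hρpost, hpriorM, ← withDensity_mul _ hprior hlik]
    congr 1
    funext z
    have hdec := residual_sq_decomposition X1k Xmk P hindep hPtP hPPt Y z.1 z.2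
    have hSinv : S⁻¹ = X1k.transpose * X1k := Matrix.nonsing_inv_nonsing_inv _ hindep
    simp only [Pi.mul_apply, hf₁, hf₂]
    rw [mulVec_fin_append, ← hX1k, ← hXmk, hdec, hSinv,
      ← ENNReal.ofReal_mul (hg_pos _).le,
      ← ENNReal.ofReal_mul (mul_nonneg (Real.exp_pos _).le (hg_pos _).le),
      neg_add, add_div, Real.exp_add]
    congr 1
    ring
  have hmap : ρpost.map (fun z : (Fin k → ℝ) × (Fin m → ℝ) => (z.1 + s z.2, z.2))
      = ((volume : Measure (Fin k → ℝ)).withDensity f₁).prod (μ.withDensity f₂) := by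
    rw [hpost, hT.map_withDensity_comp (F := fun w => f₁ w.1 * f₂ w.2)
      ((hf₁m.comp measurable_fst).mul (hf₂m.comp measurable_snd)), prod_withDensity hf₁m hf₂m]
  have h0 : (((volume : Measure (Fin k → ℝ)).withDensity f₁).prod (μ.withDensity f₂)) Set.univ
      ≠ 0 := by
    rw [← hmap, Measure.map_apply hT.measurable MeasurableSet.univ]
    exact hZpos.ne'
  rw [← probNormalize_prod _ _ h0, ← hmap]
  exact probNormalize_map ρpost hT.measurable
end

section
/- Let β⁰ ∈ ℝᵖ, ε > 0 and t ∈ ℝ, set β̂₁ = X₁ᵀY/‖X₁‖₂² − Σ_{i=2}^p γᵢβ⁰ᵢ and B = { β₋₁ ∈ ℝ^{p−1} : ‖β₋₁ − β⁰₋₁‖₁ ≤ ε }. If log g is c-Lipschitz, then the restricted variational Laplace transform satisfies E^{Q̂}[ e^{t‖X₁‖₂(β₁ − β̂₁)} 𝟙{β₋₁ ∈ B} ] ≤ e^{|t| ‖X₁‖₂ ε max_{2 ≤ i ≤ p}|γᵢ|} · Q₋₁(B) · (∫ℝ e^{tu − u²/2 + (c/‖X₁‖₂)|u|} du) / (∫ℝ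 e^{−u²/2 − (c/‖X₁‖₂)|u|} du). -/
open Matrix Finset MeasureTheory

lemma integrable_exp_quadratic_add_abs (t k : ℝ) :
    Integrable (fun u : ℝ => Real.exp (t * u - u ^ 2 / 2 + k * |u|)) := by
  have hquad (b : ℝ) : Integrable (fun u : ℝ => Real.exp (b * u - u ^ 2 / 2)) := by
    have h := (integrable_cexp_quadratic' (b := -(1 / 2 : ℂ)) (by norm_num) (b : ℂ) 0).norm
    refine h.congr (ae_of_all _ fun u => ?_)
    have hcast : (-(1 / 2 : ℂ) * (u : ℂ) ^ 2 + (b : ℂ) * (u : ℂ) + 0)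
        = ((b * u - u ^ 2 / 2 : ℝ) : ℂ) := by push_cast; ring
    simp only [hcast, Complex.norm_exp, Complex.ofReal_re]
  refine ((hquad (t + k)).add (hquad (t - k))).mono'
    (by fun_prop) (ae_of_all _ fun u => ?_)
  rw [Real.norm_eq_abs, Real.abs_exp, Pi.add_apply]
  rcases abs_cases u with ⟨h, -⟩ | ⟨h, -⟩ <;> rw [h]
  · have he : t * u - u ^ 2 / 2 + k * u = (t + k) * u - u ^ 2 / 2 := by ring
    rw [he]
    exact le_add_of_nonneg_right (Real.exp_pos _).le
  · have he : t * u - u ^ 2 / 2 + k * -u = (t - k) * u - u ^ 2 / 2 := by ring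
    rw [he]
    exact le_add_of_nonneg_left (Real.exp_pos _).le

lemma le_mul_exp_of_abs_log_sub_le {g : ℝ → ℝ} (hg_pos : ∀ x, 0 < g x) {c : ℝ}
    (hlip : ∀ x y : ℝ, |Real.log (g x) - Real.log (g y)| ≤ c * |x - y|) (x y : ℝ) :
    g x ≤ g y * Real.exp (c * |x - y|) := by
  rw [← Real.log_le_log_iff (hg_pos x) (mul_pos (hg_pos y) (Real.exp_pos _)),
    Real.log_mul (hg_pos y).ne' (Real.exp_pos _).ne', Real.log_exp]
  linarith [(abs_le.mp (hlip x y)).2]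

lemma integral_comp_mul_sub {a : ℝ} (ha : 0 < a) (μ : ℝ) (h : ℝ → ℝ) :
    ∫ u, h (a * (u - μ)) = a⁻¹ * ∫ u, h u := by
  rw [integral_sub_right_eq_self (fun u => h (a * u)) μ, Measure.integral_comp_mul_left,
    abs_of_pos (inv_pos.mpr ha), smul_eq_mul]

lemma integrable_comp_mul_sub {a : ℝ} (ha : 0 < a) (μ : ℝ) {h : ℝ → ℝ} (hh : Integrable h) :
    Integrable (fun u => h (a * (u - μ))) :=
  (hh.comp_mul_left' ha.ne').comp_sub_right μ

lemma mul_exp_gaussian_le {g : ℝ → ℝ} (hg_pos : ∀ x, 0 < g x) {c : ℝ}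
    (hlip : ∀ x y : ℝ, |Real.log (g x) - Real.log (g y)| ≤ c * |x - y|)
    {a : ℝ} (ha : 0 < a) (μ t u : ℝ) :
    Real.exp (t * a * (u - μ)) * (Real.exp (-(a ^ 2) / 2 * (u - μ) ^ 2) * g u)
      ≤ g μ * Real.exp (t * (a * (u - μ)) - (a * (u - μ)) ^ 2 / 2
          + (c / a) * |a * (u - μ)|) := by
  have hexp : t * (a * (u - μ)) - (a * (u - μ)) ^ 2 / 2 + (c / a) * |a * (u - μ)|
      = t * a * (u - μ) + (-(a ^ 2) / 2 * (u - μ) ^ 2 + c * |u - μ|) := by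
    rw [abs_mul, abs_of_pos ha]
    field_simp
    ring
  rw [hexp, Real.exp_add, Real.exp_add]
  have hg := le_mul_exp_of_abs_log_sub_le hg_pos hlip u μ
  calc _ ≤ Real.exp (t * a * (u - μ)) * (Real.exp (-(a ^ 2) / 2 * (u - μ) ^ 2)
          * (g μ * Real.exp (c * |u - μ|))) := by gcongr
    _ = _ := by ring

lemma le_exp_gaussian_mul {g : ℝ → ℝ} (hg_pos : ∀ x, 0 < g x) {c : ℝ}
    (hlip : ∀ x y : ℝ, |Real.log (g x) - Real.log (g y)| ≤ c * |x - y|)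
    {a : ℝ} (ha : 0 < a) (μ u : ℝ) :
    g μ * Real.exp (-((a * (u - μ)) ^ 2) / 2 - (c / a) * |a * (u - μ)|)
      ≤ Real.exp (-(a ^ 2) / 2 * (u - μ) ^ 2) * g u := by
  have hexp : -((a * (u - μ)) ^ 2) / 2 - (c / a) * |a * (u - μ)|
      = -(a ^ 2) / 2 * (u - μ) ^ 2 + -(c * |u - μ|) := by
    rw [abs_mul, abs_of_pos ha]
    field_simp
    ring
  rw [hexp, Real.exp_add]
  have hg := le_mul_exp_of_abs_log_sub_le hg_pos hlip μ u
  rw [abs_sub_comm] at hg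
  have hg' : g μ * Real.exp (-(c * |u - μ|)) ≤ g u := by
    rwa [Real.exp_neg, ← div_eq_mul_inv, div_le_iff₀ (Real.exp_pos _)]
  calc _ = Real.exp (-(a ^ 2) / 2 * (u - μ) ^ 2) * (g μ * Real.exp (-(c * |u - μ|))) := by ring
    _ ≤ _ := by gcongr

lemma integral_probNormalize_withDensity {f : ℝ → ℝ} (hf_meas : Measurable f)
    (hf_nonneg : ∀ x, 0 ≤ f x) (hf_int : Integrable f) (w : ℝ → ℝ) :
    ∫ u, w u ∂(probNormalize ((volume : Measure ℝ).withDensity (fun u => ENNReal.ofReal (f u))))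
      = (∫ u, w u * f u) / ∫ u, f u := by
  rw [probNormalize, integral_smul_measure, withDensity_apply _ MeasurableSet.univ,
    Measure.restrict_univ, ← ofReal_integral_eq_lintegral_ofReal hf_int (ae_of_all _ hf_nonneg),
    ENNReal.toReal_inv, ENNReal.toReal_ofReal (integral_nonneg hf_nonneg),
    integral_withDensity_eq_integral_toReal_smul (by fun_prop) (by simp)]
  simp only [ENNReal.toReal_ofReal (hf_nonneg _), smul_eq_mul]
  rw [div_eq_inv_mul]
  simp only [mul_comm]

lemma laplace_probNormalize_le {g : ℝ → ℝ} (hg_meas : Measurable g) (hg_pos : ∀ x, 0 < g x)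
    {c : ℝ} (hlip : ∀ x y : ℝ, |Real.log (g x) - Real.log (g y)| ≤ c * |x - y|)
    {a : ℝ} (ha : 0 < a) (μ t : ℝ) :
    ∫ u, Real.exp (t * a * (u - μ)) ∂(probNormalize ((volume : Measure ℝ).withDensity
        (fun u => ENNReal.ofReal (Real.exp (-(a ^ 2) / 2 * (u - μ) ^ 2) * g u))))
      ≤ (∫ u, Real.exp (t * u - u ^ 2 / 2 + (c / a) * |u|))
            / (∫ u, Real.exp (-(u ^ 2) / 2 - (c / a) * |u|)) := by
  have hf_nonneg (u : ℝ) : 0 ≤ Real.exp (-(a ^ 2) / 2 * (u - μ) ^ 2) * g u :=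
    mul_nonneg (Real.exp_pos _).le (hg_pos u).le
  have hup (t : ℝ) := (integrable_comp_mul_sub ha μ
    (integrable_exp_quadratic_add_abs t (c / a))).const_mul (g μ)
  have htilt (t : ℝ) : Integrable (fun u => Real.exp (t * a * (u - μ)) *
      (Real.exp (-(a ^ 2) / 2 * (u - μ) ^ 2) * g u)) :=
    (hup t).mono' (by fun_prop) (ae_of_all _ fun u => by
      rw [Real.norm_of_nonneg (mul_nonneg (Real.exp_pos _).le (hf_nonneg u))]
      exact mul_exp_gaussian_le hg_pos hlip ha μ t u)
  have hf_int : Integrable (fun u => Real.exp (-(a ^ 2) / 2 * (u - μ) ^ 2) * g u) := by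
    simpa using htilt 0
  have hlow : Integrable (fun u : ℝ => Real.exp (-(u ^ 2) / 2 - (c / a) * |u|)) := by
    refine (integrable_exp_quadratic_add_abs 0 (-(c / a))).congr (ae_of_all _ fun u => ?_)
    ring_nf
  have hlow_pos : 0 < ∫ u : ℝ, Real.exp (-(u ^ 2) / 2 - (c / a) * |u|) := integral_exp_pos hlow
  have hnum := integral_mono (htilt t) (hup t) (mul_exp_gaussian_le hg_pos hlip ha μ t)
  have hden := integral_mono ((integrable_comp_mul_sub ha μ hlow).const_mul (g μ)) hf_int
    (le_exp_gaussian_mul hg_pos hlip ha μ)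
  rw [integral_const_mul, integral_comp_mul_sub ha μ
    (fun u => Real.exp (t * u - u ^ 2 / 2 + (c / a) * |u|))] at hnum
  rw [integral_const_mul, integral_comp_mul_sub ha μ
    (fun u => Real.exp (-(u ^ 2) / 2 - (c / a) * |u|))] at hden
  rw [integral_probNormalize_withDensity (by fun_prop) hf_nonneg hf_int]
  have hgμ := hg_pos μ
  calc _ ≤ (g μ * (a⁻¹ * ∫ u, Real.exp (t * u - u ^ 2 / 2 + (c / a) * |u|)))
        / (g μ * (a⁻¹ * ∫ u, Real.exp (-(u ^ 2) / 2 - (c / a) * |u|))) :=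
      div_le_div₀ (by positivity) hnum (by positivity) hden
    _ = _ := by
      rw [mul_div_mul_left _ _ hgμ.ne', mul_div_mul_left _ _ (inv_pos.mpr ha).ne']

lemma abs_sum_mul_sub_le {ι : Type*} (s : Finset ι) (hs : s.Nonempty) (γ b β : ι → ℝ) :
    |∑ j ∈ s, γ j * (b j - β j)| ≤ s.sup' hs (fun j => |γ j|) * ∑ j ∈ s, |b j - β j| := by
  rw [Finset.mul_sum]
  refine (Finset.abs_sum_le_sum_abs _ _).trans (Finset.sum_le_sum fun j hj => ?_)
  rw [abs_mul]
  exact mul_le_mul_of_nonneg_right (Finset.le_sup' (fun j => |γ j|) hj) (abs_nonneg _)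

lemma integral_indicator_exp_sum_le {ι : Type*} [Fintype ι]
    (hι : (Finset.univ : Finset ι).Nonempty) (γ β : ι → ℝ) (ε : ℝ) {a : ℝ} (ha : 0 < a) (t : ℝ)
    (Q : Measure (ι → ℝ)) [IsFiniteMeasure Q] :
    ∫ b, Set.indicator {b : ι → ℝ | ∑ j, |b j - β j| ≤ ε}
        (fun b => Real.exp (-(t * a) * ∑ j, γ j * (b j - β j))) b ∂Q
      ≤ Real.exp (|t| * a * ε * Finset.univ.sup' hι (fun j => |γ j|))
        * (Q {b : ι → ℝ | ∑ j, |b j - β j| ≤ ε}).toReal := by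
  set M := Finset.univ.sup' hι (fun j => |γ j|)
  have hM_nonneg : 0 ≤ M := by
    obtain ⟨j, hj⟩ := hι
    exact (abs_nonneg _).trans (Finset.le_sup' (fun j => |γ j|) hj)
  have hB : MeasurableSet {b : ι → ℝ | ∑ j, |b j - β j| ≤ ε} :=
    measurableSet_le (by fun_prop) measurable_const
  have hbound (b : ι → ℝ) (hb : ∑ j, |b j - β j| ≤ ε) :
      Real.exp (-(t * a) * ∑ j, γ j * (b j - β j)) ≤ Real.exp (|t| * a * ε * M) := by
    have hsum : |∑ j, γ j * (b j - β j)| ≤ M * ε :=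
      (abs_sum_mul_sub_le Finset.univ hι γ b β).trans (mul_le_mul_of_nonneg_left hb hM_nonneg)
    rw [Real.exp_le_exp]
    calc _ ≤ |-(t * a) * ∑ j, γ j * (b j - β j)| := le_abs_self _
      _ = |t| * a * |∑ j, γ j * (b j - β j)| := by
        rw [abs_mul, abs_neg, abs_mul, abs_of_pos ha]
      _ ≤ |t| * a * (M * ε) := by gcongr
      _ = |t| * a * ε * M := by ring
  calc _ ≤ ∫ b, Set.indicator {b : ι → ℝ | ∑ j, |b j - β j| ≤ ε}
        (fun _ => Real.exp (|t| * a * ε * M)) b ∂Q :=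
      integral_mono_of_nonneg
        (ae_of_all _ fun b => Set.indicator_nonneg (fun _ _ => (Real.exp_pos _).le) b)
        ((integrable_const _).indicator hB)
        (ae_of_all _ fun b => Set.indicator_le_indicator' (hbound b))
    _ = _ := by rw [integral_indicator_const _ hB, smul_eq_mul, mul_comm, measureReal_def]

/-- Let `β̂₁ = X₁ᵀY/‖X₁‖₂² − ∑_{i=2}^p γᵢβ⁰ᵢ` and
`B = {β₋₁ : ‖β₋₁ − β⁰₋₁‖₁ ≤ ε}`.  If `log g` is `c`-Lipschitz, the variational posterior `Q̂`
(the law of `(β₁* − ∑_{i≥2} γᵢβᵢ, β₋₁)` with `β₁*` having density `∝ e^{−(‖X₁‖₂²/2)(u − X₁ᵀY/‖X₁‖₂²)²} g(u)`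
independent of `β₋₁ ∼ Q₋₁`) satisfies
`E^{Q̂}[e^{t‖X₁‖₂(β₁ − β̂₁)}𝟙{β₋₁ ∈ B}] ≤ e^{|t|‖X₁‖₂ε·maxᵢ|γᵢ|}·Q₋₁(B)·(∫ e^{tu−u²/2+(c/‖X₁‖₂)|u|}du)/(∫ e^{−u²/2−(c/‖X₁‖₂)|u|}du)`.
Here `ℝᵖ` is identified with `ℝ × ℝ^{p−1}` via `β = (β₁, β₋₁)` and `p = m + 1`. -/
theorem stmt17 (n m : ℕ) (hn : 2 ≤ n) (hm : 0 < m)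
    (X : Matrix (Fin n) (Fin (m + 1)) ℝ)
    (hX1 : (fun i => X i 0) ≠ 0)
    (Y : Fin n → ℝ) (β0 : Fin (m + 1) → ℝ) (ε : ℝ) (hε : 0 < ε) (t : ℝ)
    (g : ℝ → ℝ) (hg_meas : Measurable g) (hg_pos : ∀ x, 0 < g x)
    (hg_int : ∫ x, g x = 1)
    (c : ℝ) (hc : 0 ≤ c)
    (hlip : ∀ x y : ℝ, |Real.log (g x) - Real.log (g y)| ≤ c * |x - y|)
    (Qm1 : Measure (Fin m → ℝ)) [IsProbabilityMeasure Qm1] :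
    let γ : Fin (m + 1) → ℝ := fun j => (∑ i, X i 0 * X i j) / (∑ l, X l 0 ^ 2)
    let a : ℝ := Real.sqrt (∑ l, X l 0 ^ 2)
    let βhat1 : ℝ := (∑ i, X i 0 * Y i) / (∑ l, X l 0 ^ 2) - ∑ j : Fin m, γ j.succ * β0 j.succ
    let B : Set (Fin m → ℝ) := {b | (∑ j, |b j - β0 j.succ|) ≤ ε}
    let ν₁ : Measure ℝ := probNormalize ((volume : Measure ℝ).withDensity
      (fun u => ENNReal.ofReal
        (Real.exp (-(∑ l, X l 0 ^ 2) / 2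
            * (u - (∑ i, X i 0 * Y i) / (∑ l, X l 0 ^ 2)) ^ 2) * g u)))
    let Qhat : Measure (ℝ × (Fin m → ℝ)) :=
      (ν₁.prod Qm1).map (fun z => (z.1 - ∑ j : Fin m, γ j.succ * z.2 j, z.2))
    (∫ z, Set.indicator {z : ℝ × (Fin m → ℝ) | z.2 ∈ B}
        (fun z => Real.exp (t * a * (z.1 - βhat1))) z ∂Qhat)
      ≤ Real.exp (|t| * a * ε
            * Finset.univ.sup' ⟨⟨0, hm⟩, Finset.mem_univ _⟩ (fun j : Fin m => |γ j.succ|))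
        * (Qm1 B).toReal
        * ((∫ u, Real.exp (t * u - u ^ 2 / 2 + (c / a) * |u|))
            / (∫ u, Real.exp (-(u ^ 2) / 2 - (c / a) * |u|))) := by
  intro γ a βhat1 B ν₁ Qhat
  have hs : 0 < ∑ l, X l 0 ^ 2 := by
    obtain ⟨i, hi⟩ := Function.ne_iff.mp hX1
    have hi' : X i 0 ≠ 0 := hi
    exact Finset.sum_pos' (fun l _ => sq_nonneg _) ⟨i, Finset.mem_univ _, by positivity⟩
  have ha : 0 < a := Real.sqrt_pos.mpr hs
  have ha2 : ∑ l, X l 0 ^ 2 = a ^ 2 := (Real.sq_sqrt hs.le).symm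
  have hν₁ : SFinite ν₁ := by
    unfold ν₁ probNormalize
    infer_instance
  have hB : MeasurableSet B := measurableSet_le (by fun_prop) measurable_const
  set μ : ℝ := (∑ i, X i 0 * Y i) / (∑ l, X l 0 ^ 2)
  set M : ℝ := Finset.univ.sup' ⟨⟨0, hm⟩, Finset.mem_univ _⟩ (fun j : Fin m => |γ j.succ|)
  have hfactor : ∫ z, Set.indicator {z : ℝ × (Fin m → ℝ) | z.2 ∈ B}
        (fun z => Real.exp (t * a * (z.1 - βhat1))) z ∂Qhat
      = (∫ u, Real.exp (t * a * (u - μ)) ∂ν₁) * ∫ b, B.indicator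
          (fun b => Real.exp (-(t * a) * ∑ j : Fin m, γ j.succ * (b j - β0 j.succ))) b ∂Qm1 := by
    rw [← integral_prod_mul, integral_map (by fun_prop)]
    · refine integral_congr_ae (ae_of_all _ fun z => ?_)
      by_cases hz : z.2 ∈ B
      · simp only [Set.indicator, Set.mem_ofPred_eq, hz, if_true]
        rw [← Real.exp_add]
        congr 1
        simp only [βhat1, mul_sub, Finset.sum_sub_distrib]
        ring
      · simp [Set.indicator, hz]
    · exact (Measurable.indicator (by fun_prop) (measurable_snd hB)).aestronglyMeasurable
  have hlaplace : ∫ u, Real.exp (t * a * (u - μ)) ∂ν₁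
      ≤ (∫ u, Real.exp (t * u - u ^ 2 / 2 + (c / a) * |u|))
            / (∫ u, Real.exp (-(u ^ 2) / 2 - (c / a) * |u|)) := by
    have h := laplace_probNormalize_le hg_meas hg_pos hlip ha μ t
    rwa [← ha2] at h
  have hrest : ∫ b, B.indicator
        (fun b => Real.exp (-(t * a) * ∑ j : Fin m, γ j.succ * (b j - β0 j.succ))) b ∂Qm1
      ≤ Real.exp (|t| * a * ε * M) * (Qm1 B).toReal :=
    integral_indicator_exp_sum_le ⟨⟨0, hm⟩, Finset.mem_univ _⟩ (fun j => γ j.succ)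
      (fun j => β0 j.succ) ε ha t Qm1
  rw [hfactor, mul_comm]
  exact mul_le_mul hrest hlaplace (integral_nonneg fun u => (Real.exp_pos _).le) (by positivity)
end
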